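/- Let Q be a mutation-cyclic quiver on three vertices with exchange matrix B. Then the framed quiver [B | I_3] of Q is not mutation-equivalent to any ice quiver in which all three mutable vertices are red; in particular, Q does not admit a reddening sequence. -/

import Mathlib

open Matrix

section QuiverDefs

variable {V W : Type*}

/-- Mutation of an exchange matrix at the vertex `k`. -/
def mutB [DecidableEq V] (B : Matrix V V ℤ) (k : V) : Matrix V V ℤ :=
  Matrix.of fun i j =>
    if i = k ∨ j = k then -B i j else B i j + (B i k).sign * max (B i k * B k j) 0

/-- Mutation of the `C`-matrix of an extended exchange matrix `[B | C]` at the vertex `k`. -/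
def mutC [DecidableEq V] (B : Matrix V V ℤ) (C : Matrix V W ℤ) (k : V) : Matrix V W ℤ :=
  Matrix.of fun i j =>
    if i = k then -C i j else C i j + (B i k).sign * max (B i k * C k j) 0

/-- One mutation step on an extended exchange matrix `[B | C]`, regarded as a pair `(B, C)`. -/
def mutPair [DecidableEq V] (P : Matrix V V ℤ × Matrix V W ℤ) (k : V) :
    Matrix V V ℤ × Matrix V W ℤ :=
  (mutB P.1 k, mutC P.1 P.2 k)

/-- Iterated mutation of an extended exchange matrix along a list of mutable vertices. -/
def mutSeqPair [DecidableEq V] (P : Matrix V V ℤ × Matrix V W ℤ) (w : List V) :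
    Matrix V V ℤ × Matrix V W ℤ :=
  w.foldl mutPair P

/-- Iterated mutation of an exchange matrix along a list of vertices. -/
def mutSeqB [DecidableEq V] (B : Matrix V V ℤ) (w : List V) : Matrix V V ℤ :=
  w.foldl mutB B

/-- A quiver is abundant if there are at least two arrows between any two distinct vertices. -/
def QAbundant (B : Matrix V V ℤ) : Prop := ∀ i j, i ≠ j → 2 ≤ |B i j|

/-- There is a directed cycle of the quiver `B` all of whose vertices lie in `S`. -/
def HasCycleIn (B : Matrix V V ℤ) (S : Set V) : Prop :=
  ∃ (x : V) (l : List V), x ∈ S ∧ (∀ y ∈ l, y ∈ S) ∧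
    List.Chain (fun i j => 0 < B i j) x (l ++ [x])

/-- A quiver is acyclic if it has no directed cycle. -/
def QAcyclic (B : Matrix V V ℤ) : Prop := ¬ HasCycleIn B Set.univ

/-- The vertex `x` is a source: all arrows at `x` point away from `x`. -/
def QSource (B : Matrix V V ℤ) (x : V) : Prop := ∀ j, 0 ≤ B x j

/-- The vertex `x` is a sink: all arrows at `x` point into `x`. -/
def QSink (B : Matrix V V ℤ) (x : V) : Prop := ∀ j, B x j ≤ 0

/-- `B` is a fork with point of return `r`: it is abundant, not acyclic, the full subquiver
obtained by deleting `r` is acyclic, and for all `i` with `i → r` and `j` with `r → j` one has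
`b_{ji} > b_{ir}` and `b_{ji} > b_{rj}`. -/
def QFork (B : Matrix V V ℤ) (r : V) : Prop :=
  QAbundant B ∧ ¬ QAcyclic B ∧ ¬ HasCycleIn B {x | x ≠ r} ∧
    ∀ i j, 0 < B i r → 0 < B r j → B i r < B j i ∧ B r j < B j i

/-- The mutable vertex `i` is green: its `c`-vector is nonzero with all entries `≥ 0`. -/
def QGreen (C : Matrix V W ℤ) (i : V) : Prop := (∀ j, 0 ≤ C i j) ∧ C i ≠ 0

/-- The mutable vertex `i` is red: its `c`-vector is nonzero with all entries `≤ 0`. -/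
def QRed (C : Matrix V W ℤ) (i : V) : Prop := (∀ j, C i j ≤ 0) ∧ C i ≠ 0

/-- The mutable vertex `i` is blue: its `c`-vector is zero. -/
def QBlue (C : Matrix V W ℤ) (i : V) : Prop := C i = 0

/-- `i` has the same color (red/green/blue) with respect to `C` and to `C'`. -/
def SameColorQ (C C' : Matrix V W ℤ) (i : V) : Prop :=
  (QRed C i ↔ QRed C' i) ∧ (QGreen C i ↔ QGreen C' i) ∧ (QBlue C i ↔ QBlue C' i)

/-- The `c`-vectors of `i` and `j` have the same sign (`sgn(c_i) = sgn(c_j)`). -/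
def SameSignQ (C : Matrix V W ℤ) (i j : V) : Prop :=
  (QGreen C i ∧ QGreen C j) ∨ (QRed C i ∧ QRed C j)

/-- The `c`-vectors of `i` and `j` have opposite signs (`sgn(c_i) = -sgn(c_j)`). -/
def OppSignQ (C : Matrix V W ℤ) (i j : V) : Prop :=
  (QGreen C i ∧ QRed C j) ∨ (QRed C i ∧ QGreen C j)

/-- An ice quiver is uniformly sign-coherent if after every mutation sequence every mutable
vertex is red, green, or blue, and not every mutable vertex of the initial quiver is blue. -/
def USC [DecidableEq V] (P : Matrix V V ℤ × Matrix V W ℤ) : Prop :=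
  (∀ (w : List V) (i : V),
      QRed (mutSeqPair P w).2 i ∨ QGreen (mutSeqPair P w).2 i ∨ QBlue (mutSeqPair P w).2 i) ∧
    ¬ ∀ i, QBlue P.2 i

/-- An ice quiver is strictly sign-coherent if after every mutation sequence every mutable
vertex is red or green. -/
def SSC [DecidableEq V] (P : Matrix V V ℤ × Matrix V W ℤ) : Prop :=
  ∀ (w : List V) (i : V), QRed (mutSeqPair P w).2 i ∨ QGreen (mutSeqPair P w).2 i

/-- The four sign conditions at the distinguished vertex `r`:
(1) every mutable vertex is red or green;
(2) if every entry of `b_{rj}·c_j` is `≥ 0` for some `j ≠ r`, then `sgn(c_j) = sgn(c_r)` or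
    `sgn(c_j)·c_j ≥ sgn(c_r)·c_r` entrywise (i.e. `|c_r| ≤ |c_j|` entrywise);
(3) if every entry of `b_{rj}·c_j` is `≤ 0` for some `j ≠ r`, then `sgn(c_j) = -sgn(c_r)`;
(4) if every entry of `b_{ij}·c_j` is `≥ 0` for distinct `i, j` both `≠ r`,
    then `sgn(c_i) = sgn(c_j)`. -/
def FourConds (Bw : Matrix V V ℤ) (Cw : Matrix V W ℤ) (r : V) : Prop :=
  (∀ i, QRed Cw i ∨ QGreen Cw i) ∧
  (∀ j, j ≠ r → (∀ t, 0 ≤ Bw r j * Cw j t) →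
    (SameSignQ Cw j r ∨ ∀ t, |Cw r t| ≤ |Cw j t|)) ∧
  (∀ j, j ≠ r → (∀ t, Bw r j * Cw j t ≤ 0) → OppSignQ Cw j r) ∧
  (∀ i j, i ≠ j → i ≠ r → j ≠ r → (∀ t, 0 ≤ Bw i j * Cw j t) → SameSignQ Cw i j)

end QuiverDefs

/-- A skew-symmetric exchange matrix none of whose mutations is acyclic. -/
def GoodB (B : Matrix (Fin 3) (Fin 3) ℤ) : Prop :=
  (∀ i j, B j i = -B i j) ∧ ∀ w : List (Fin 3), ¬ QAcyclic (mutSeqB B w)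

theorem mutB_skew {B : Matrix (Fin 3) (Fin 3) ℤ} (h : ∀ i j, B j i = -B i j) (k : Fin 3) :
    ∀ i j, mutB B k j i = -mutB B k i j := by
  intro i j
  simp only [mutB, Matrix.of_apply]
  by_cases hi : i = k
  · simp [hi, h k j]
  by_cases hj : j = k
  · simp [hj, h k i]
  simp only [hi, hj, or_self, if_false]
  rw [h i j, h k j, h i k]
  have e : -B k j * -B i k = B i k * B k j := by ring
  rw [e]
  rcases le_or_gt (B i k * B k j) 0 with h0 | h0
  · simp [max_eq_right h0]
  · have : (B i k).sign = (B k j).sign := by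
      rcases lt_trichotomy (B i k) 0 with h1 | h1 | h1
      · have : B k j < 0 := by nlinarith
        rw [Int.sign_eq_neg_one_of_neg h1, Int.sign_eq_neg_one_of_neg this]
      · simp [h1] at h0
      · have : 0 < B k j := by nlinarith
        rw [Int.sign_eq_one_of_pos h1, Int.sign_eq_one_of_pos this]
    rw [this, Int.sign_neg]
    ring

theorem GoodB.mut {B : Matrix (Fin 3) (Fin 3) ℤ} (h : GoodB B) (k : Fin 3) :
    GoodB (mutB B k) :=
  ⟨mutB_skew h.1 k, fun w => h.2 (k :: w)⟩

theorem acyclic_of_height {B : Matrix (Fin 3) (Fin 3) ℤ} (f : Fin 3 → ℕ)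
    (hf : ∀ i j, 0 < B i j → f i < f j) : QAcyclic B := by
  rintro ⟨x, l, -, -, hc⟩
  have key : ∀ (m : List (Fin 3)) (x y : Fin 3),
      List.IsChain (fun i j => 0 < B i j) (x :: (m ++ [y])) → f x < f y := by
    intro m
    induction m with
    | nil => intro x y h; simp at h; exact hf _ _ h
    | cons a m ih =>
      intro x y h
      simp only [List.cons_append, List.isChain_cons_cons] at h
      exact (hf _ _ h.1).trans (ih a y h.2)
  exact lt_irrefl _ (key l x x hc)

theorem fin3_cover {x y z : Fin 3} (hxy : x ≠ y) (hyz : y ≠ z) (hzx : z ≠ x) (i : Fin 3) :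
    i = x ∨ i = y ∨ i = z := by
  lia

theorem GoodB.cyc {B : Matrix (Fin 3) (Fin 3) ℤ} (h : GoodB B) {x y z : Fin 3}
    (hxy : x ≠ y) (hyz : y ≠ z) (hzx : z ≠ x) (hp : 0 < B x y) : 0 < B y z ∧ 0 < B z x := by
  by_contra hn
  have hd : ∀ i, B i i = 0 := fun i => by have := h.1 i i; lia
  have s1 := h.1 x y
  have s2 := h.1 y z
  have s3 := h.1 z x
  have d1 := hd x
  have d2 := hd y
  have d3 := hd z
  have hA : ∀ p q r : ℕ, (p < q) → (0 < B y z → q < r) → (0 < B z y → r < q) →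
      (0 < B z x → r < p) → (0 < B x z → p < r) → False := by
    intro p q r h1 h2 h3 h4 h5
    refine h.2 [] (acyclic_of_height (fun i => if i = x then p else if i = y then q else r) ?_)
    intro i j hij
    simp only [mutSeqB, List.foldl_nil] at hij
    rcases fin3_cover hxy hyz hzx i with rfl | rfl | rfl <;>
    rcases fin3_cover hxy hyz hzx j with rfl | rfl | rfl <;>
    simp_all [eq_comm] <;> lia
  by_cases h1 : 0 < B y z
  · have h2 : ¬ 0 < B z x := fun h2 => hn ⟨h1, h2⟩
    exact hA 0 1 2 (by lia) (by lia) (by lia) (by lia) (by lia)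
  · by_cases h2 : 0 < B z x
    · exact hA 1 2 0 (by lia) (by lia) (by lia) (by lia) (by lia)
    · exact hA 0 2 1 (by lia) (by lia) (by lia) (by lia) (by lia)

theorem GoodB.lt_mul {B : Matrix (Fin 3) (Fin 3) ℤ} (h : GoodB B) {x y z : Fin 3}
    (hxy : x ≠ y) (hyz : y ≠ z) (hzx : z ≠ x) (hp : 0 < B x y) :
    B z x < B x y * B y z := by
  obtain ⟨h1, h2⟩ := h.cyc hxy hyz hzx hp
  have hyx : 0 < mutB B y y x := by
    simp [mutB]; rw [h.1 x y]; lia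
  have := ((h.mut y).cyc hxy.symm hzx.symm hyz.symm hyx).1
  simp only [mutB, Matrix.of_apply, hxy, hyz.symm, or_self, if_false,
    Int.sign_eq_one_of_pos hp, max_eq_left (mul_pos hp h1).le] at this
  rw [h.1 z x] at this
  lia

theorem GoodB.two_le {B : Matrix (Fin 3) (Fin 3) ℤ} (h : GoodB B) {x y z : Fin 3}
    (hxy : x ≠ y) (hyz : y ≠ z) (hzx : z ≠ x) (hp : 0 < B x y) : 2 ≤ B x y := by
  obtain ⟨h1, h2⟩ := h.cyc hxy hyz hzx hp
  have e1 := h.lt_mul hxy hyz hzx hp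
  have e3 := h.lt_mul hzx hxy hyz h2
  by_contra hlt
  have : B x y = 1 := by lia
  rw [this] at e1 e3
  lia

theorem GoodB.exists_succ {B : Matrix (Fin 3) (Fin 3) ℤ} (h : GoodB B) (r : Fin 3) :
    ∃ j k, r ≠ j ∧ j ≠ k ∧ k ≠ r ∧ 0 < B r j := by
  have : ∃ x y, 0 < B x y := by
    by_contra hn
    push Not at hn
    exact h.2 [] (acyclic_of_height (fun _ => 0) fun i j hij => absurd hij (not_lt.2 (hn i j)))
  obtain ⟨x, y, hp⟩ := this
  have hxy : x ≠ y := by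
    rintro rfl
    have := h.1 x x
    lia
  obtain ⟨z, hyz, hzx⟩ : ∃ z, y ≠ z ∧ z ≠ x := by
    have key : ∀ x y : Fin 3, ∃ z, y ≠ z ∧ z ≠ x := by decide
    exact key x y
  obtain ⟨h1, h2⟩ := h.cyc hxy hyz hzx hp
  rcases fin3_cover hxy hyz hzx r with rfl | rfl | rfl
  · exact ⟨_, _, hxy, hyz, hzx, hp⟩
  · exact ⟨_, _, hyz, hzx, hxy, h1⟩
  · exact ⟨_, _, hzx, hxy, hyz, h2⟩

theorem mutPair_invol (P : Matrix (Fin 3) (Fin 3) ℤ × Matrix (Fin 3) (Fin 3) ℤ) (k : Fin 3) :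
    mutPair (mutPair P k) k = P := by
  obtain ⟨B, C⟩ := P
  refine Prod.ext ?_ ?_
  · ext i j
    by_cases hi : i = k
    · simp [mutPair, mutB, hi]
    by_cases hj : j = k
    · simp [mutPair, mutB, hj]
    simp [mutPair, mutB, hi, hj]
  · ext i j
    by_cases hi : i = k
    · simp [mutPair, mutC, hi]
    simp [mutPair, mutC, mutB, hi]

/-- The sign pattern kept along reduced mutation sequences; `r` is the last mutated vertex,
and the quiver is the cycle `r → j → k → r`. -/
def SignInv (B C : Matrix (Fin 3) (Fin 3) ℤ) (r : Fin 3) : Prop :=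
  ∃ j k, r ≠ j ∧ j ≠ k ∧ k ≠ r ∧ 0 < B r j ∧
    (((∀ t, 0 ≤ C r t ∧ C k t ≤ 0 ∧ C r t ≤ -C k t) ∧ ((∀ t, 0 ≤ C j t) ∨ ∀ t, C j t ≤ 0)) ∨
     ((∀ t, C r t ≤ 0 ∧ 0 ≤ C j t ∧ -C r t ≤ C j t) ∧ ((∀ t, 0 ≤ C k t) ∨ ∀ t, C k t ≤ 0)))

theorem mutC_self (B C : Matrix (Fin 3) (Fin 3) ℤ) (k t : Fin 3) :
    mutC B C k k t = -C k t := by simp [mutC]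

theorem mutC_pos_nonneg {B C : Matrix (Fin 3) (Fin 3) ℤ} {i k t : Fin 3} (hik : i ≠ k)
    (hb : 0 < B i k) (hc : 0 ≤ C k t) : mutC B C k i t = C i t + B i k * C k t := by
  simp [mutC, hik, Int.sign_eq_one_of_pos hb, max_eq_left (mul_nonneg hb.le hc)]

theorem mutC_pos_nonpos {B C : Matrix (Fin 3) (Fin 3) ℤ} {i k t : Fin 3} (hik : i ≠ k)
    (hb : 0 < B i k) (hc : C k t ≤ 0) : mutC B C k i t = C i t := by
  simp [mutC, hik, max_eq_right (mul_nonpos_of_nonneg_of_nonpos hb.le hc)]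

theorem mutC_neg_nonneg {B C : Matrix (Fin 3) (Fin 3) ℤ} {i k t : Fin 3} (hik : i ≠ k)
    (hb : B i k < 0) (hc : 0 ≤ C k t) : mutC B C k i t = C i t := by
  simp [mutC, hik, max_eq_right (mul_nonpos_of_nonpos_of_nonneg hb.le hc)]

theorem mutC_neg_nonpos {B C : Matrix (Fin 3) (Fin 3) ℤ} {i k t : Fin 3} (hik : i ≠ k)
    (hb : B i k < 0) (hc : C k t ≤ 0) : mutC B C k i t = C i t - B i k * C k t := by
  simp [mutC, hik, Int.sign_eq_neg_one_of_neg hb, max_eq_left (mul_nonneg_of_nonpos_of_nonpos hb.le hc)]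
  ring

theorem SignInv.step {B C : Matrix (Fin 3) (Fin 3) ℤ} {r : Fin 3} (hB : GoodB B)
    (h : SignInv B C r) {v : Fin 3} (hv : v ≠ r) : SignInv (mutB B v) (mutC B C v) v := by
  obtain ⟨j, k, hrj, hjk, hkr, hp, h⟩ := h
  obtain ⟨hp1, hp2⟩ := hB.cyc hrj hjk hkr hp
  have a2 := hB.two_le hrj hjk hkr hp
  have b2 := hB.two_le hjk hkr hrj hp1
  have c2 := hB.two_le hkr hrj hjk hp2
  have s1 := hB.1 r j
  have s2 := hB.1 j k
  have s3 := hB.1 k r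
  rcases fin3_cover hrj hjk hkr v with rfl | rfl | rfl
  · exact absurd rfl hv
  · -- mutation at the successor; new cycle is `v → r → k → v`
    have n1 : B k v < 0 := by lia
    refine ⟨r, k, hrj.symm, hkr.symm, hjk.symm, by simp [mutB]; lia, ?_⟩
    have plus : (∀ t, 0 ≤ C v t) → (∀ t, -C v t ≤ C r t) → ((∀ t, 0 ≤ C k t) ∨ ∀ t, C k t ≤ 0) →
        ((∀ t, mutC B C v v t ≤ 0 ∧ 0 ≤ mutC B C v r t ∧ -mutC B C v v t ≤ mutC B C v r t) ∧
          ((∀ t, 0 ≤ mutC B C v k t) ∨ ∀ t, mutC B C v k t ≤ 0)) := by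
      intro h1 h2 h3
      refine ⟨fun t => ?_, ?_⟩
      · have := h1 t
        have := h2 t
        rw [mutC_self, mutC_pos_nonneg hrj hp (h1 t)]
        refine ⟨by lia, by nlinarith, by nlinarith⟩
      · simpa only [fun t => mutC_neg_nonneg hjk.symm n1 (h1 t)] using h3
    rcases h with ⟨h1, h2 | h2⟩ | ⟨h1, h2⟩
    · right
      exact plus h2 (fun t => by have := h1 t; have := h2 t; lia) (Or.inr fun t => (h1 t).2.1)
    · left
      refine ⟨fun t => ?_, Or.inl fun t => ?_⟩
      · have := h1 t
        have := h2 t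
        rw [mutC_self, mutC_neg_nonpos hjk.symm n1 (h2 t)]
        refine ⟨by lia, by nlinarith, by nlinarith⟩
      · rw [mutC_pos_nonpos hrj hp (h2 t)]
        exact (h1 t).1
    · right
      exact plus (fun t => (h1 t).2.1) (fun t => by have := h1 t; lia) h2
  · -- mutation at the predecessor; new cycle is `v → j → r → v`
    have n1 : B r v < 0 := by lia
    refine ⟨j, r, hjk.symm, hrj.symm, hkr.symm, by simp [mutB]; lia, ?_⟩
    have minus : (∀ t, C v t ≤ 0) → (∀ t, C r t ≤ -C v t) → ((∀ t, 0 ≤ C j t) ∨ ∀ t, C j t ≤ 0) →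
        ((∀ t, 0 ≤ mutC B C v v t ∧ mutC B C v r t ≤ 0 ∧ mutC B C v v t ≤ -mutC B C v r t) ∧
          ((∀ t, 0 ≤ mutC B C v j t) ∨ ∀ t, mutC B C v j t ≤ 0)) := by
      intro h1 h2 h3
      refine ⟨fun t => ?_, ?_⟩
      · have := h1 t
        have := h2 t
        rw [mutC_self, mutC_neg_nonpos hkr.symm n1 (h1 t)]
        refine ⟨by lia, by nlinarith, by nlinarith⟩
      · simpa only [fun t => mutC_pos_nonpos hjk hp1 (h1 t)] using h3
    rcases h with ⟨h1, h2⟩ | ⟨h1, h2 | h2⟩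
    · left
      exact minus (fun t => (h1 t).2.1) (fun t => by have := h1 t; lia) h2
    · right
      refine ⟨fun t => ?_, Or.inr fun t => ?_⟩
      · have := h1 t
        have := h2 t
        rw [mutC_self, mutC_pos_nonneg hjk hp1 (h2 t)]
        refine ⟨by lia, by nlinarith, by nlinarith⟩
      · rw [mutC_neg_nonneg hkr.symm n1 (h2 t)]
        exact (h1 t).1
    · left
      exact minus h2 (fun t => by have := h1 t; have := h2 t; lia) (Or.inl fun t => (h1 t).2.1)

theorem SignInv.base {B : Matrix (Fin 3) (Fin 3) ℤ} (hB : GoodB B) (v : Fin 3) :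
    SignInv (mutB B v) (mutC B 1 v) v := by
  obtain ⟨j, k, hrj, hjk, hkr, hp⟩ := hB.exists_succ v
  obtain ⟨hp1, hp2⟩ := hB.cyc hrj hjk hkr hp
  have s1 := hB.1 v j
  have n1 : B j v < 0 := by lia
  have one_nonneg' : ∀ i t : Fin 3, 0 ≤ (1 : Matrix (Fin 3) (Fin 3) ℤ) i t := by
    intro i t
    rw [Matrix.one_apply]
    split_ifs <;> lia
  refine ⟨k, j, hkr.symm, hjk.symm, hrj.symm, by simp [mutB]; have := hB.1 k v; lia, Or.inr
    ⟨fun t => ?_, Or.inl fun t => ?_⟩⟩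
  · have := one_nonneg' v t
    have := one_nonneg' k t
    rw [mutC_self, mutC_pos_nonneg hkr hp2 (one_nonneg' v t)]
    refine ⟨by lia, by nlinarith, by nlinarith⟩
  · rw [mutC_neg_nonneg hrj.symm n1 (one_nonneg' v t)]
    exact one_nonneg' j t

theorem SignInv.not_red {B C : Matrix (Fin 3) (Fin 3) ℤ} {r : Fin 3} (h : SignInv B C r) :
    ¬ ∀ i, QRed C i := by
  intro hr
  obtain ⟨j, k, -, -, -, -, h⟩ := h
  rcases h with ⟨h1, -⟩ | ⟨h1, -⟩
  · exact (hr r).2 (funext fun t => le_antisymm ((hr r).1 t) (h1 t).1)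
  · exact (hr j).2 (funext fun t => le_antisymm ((hr j).1 t) (h1 t).2.1)

/-- Ice quivers reached from `P₀` by a nonempty reduced mutation sequence ending in the
given vertex. -/
inductive RReach (P₀ : Matrix (Fin 3) (Fin 3) ℤ × Matrix (Fin 3) (Fin 3) ℤ) :
    Matrix (Fin 3) (Fin 3) ℤ × Matrix (Fin 3) (Fin 3) ℤ → Fin 3 → Prop
  | base (r : Fin 3) : RReach P₀ (mutPair P₀ r) r
  | step {P : Matrix (Fin 3) (Fin 3) ℤ × Matrix (Fin 3) (Fin 3) ℤ} {r : Fin 3} (v : Fin 3)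
      (hv : v ≠ r) (h : RReach P₀ P r) : RReach P₀ (mutPair P v) v

theorem RReach.inv {B : Matrix (Fin 3) (Fin 3) ℤ} (hB : GoodB B)
    {P : Matrix (Fin 3) (Fin 3) ℤ × Matrix (Fin 3) (Fin 3) ℤ} {r : Fin 3}
    (h : RReach (B, 1) P r) : GoodB P.1 ∧ SignInv P.1 P.2 r := by
  induction h with
  | base r => exact ⟨hB.mut r, SignInv.base hB r⟩
  | step v hv _ ih => exact ⟨ih.1.mut v, ih.2.step ih.1 hv⟩

theorem RReach.mut {P₀ P : Matrix (Fin 3) (Fin 3) ℤ × Matrix (Fin 3) (Fin 3) ℤ}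
    (h : P = P₀ ∨ ∃ r, RReach P₀ P r) (v : Fin 3) :
    mutPair P v = P₀ ∨ ∃ r, RReach P₀ (mutPair P v) r := by
  rcases h with rfl | ⟨r, h⟩
  · exact Or.inr ⟨v, .base v⟩
  · by_cases hv : v = r
    · subst hv
      cases h with
      | base => exact Or.inl (mutPair_invol _ _)
      | step _ hv h => rw [mutPair_invol]; exact Or.inr ⟨_, h⟩
    · exact Or.inr ⟨v, .step v hv h⟩

theorem RReach.seq {P₀ : Matrix (Fin 3) (Fin 3) ℤ × Matrix (Fin 3) (Fin 3) ℤ}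
    (w : List (Fin 3)) : ∀ P, (P = P₀ ∨ ∃ r, RReach P₀ P r) →
      (mutSeqPair P w = P₀ ∨ ∃ r, RReach P₀ (mutSeqPair P w) r) := by
  induction w with
  | nil => intro P h; exact h
  | cons v w ih => intro P h; exact ih _ (RReach.mut h v)

/-- Lemma `lem-red-seq-3-cycle`. -/
theorem no_reddening_three_cyclic
    (B : Matrix (Fin 3) (Fin 3) ℤ)
    (hskew : ∀ i j, B j i = -B i j)
    (hcyc : ∀ w : List (Fin 3), ¬ QAcyclic (mutSeqB B w)) :
    ∀ w : List (Fin 3),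
      ¬ ∀ i, QRed (mutSeqPair (B, (1 : Matrix (Fin 3) (Fin 3) ℤ)) w).2 i := by
  intro w
  rcases RReach.seq w (B, (1 : Matrix (Fin 3) (Fin 3) ℤ)) (Or.inl rfl) with h | ⟨r, h⟩
  · rw [h]
    intro hr
    have := (hr 0).1 0
    simp at this
  · exact (h.inv ⟨hskew, hcyc⟩).2.not_red
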